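/- arXiv:2202.06921 — 6 statements merged into one kernel-verified Lean document; each statement's English description precedes it below -/
import Mathlib

section
/- Let Ω be a real symmetric n×n matrix, e₁ the first standard basis vector of ℝⁿ, and S a real invertible n×n matrix satisfying the matrix equation SᵀS − e₁e₁ᵀSᵀΩS = I. Then there exist a real number λ < 1 and a unit vector u ∈ ℝⁿ with Ωu = λu such that: (i) Se₁ = (1−λ)^{-1/2}·u; (ii) (Sᵀ)^{-1}e₁ = (1−λ)^{1/2}·u; and (iii) SSᵀ = I + (λ/(1−λ))·uuᵀ. -/
open Matrix

/-- If `1 + e wᵀ` is symmetric and `e` is a unit vector, then `w` is a multiple of `e`. -/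
theorem eq_smul_of_isSymm_one_add_vecMulVec {ι : Type*} [Fintype ι] [DecidableEq ι]
    {e w : ι → ℝ} (he : e ⬝ᵥ e = 1) (h : (1 + vecMulVec e w).IsSymm) :
    w = (w ⬝ᵥ e) • e := by
  have hsymm : vecMulVec w e = vecMulVec e w := by
    simpa [Matrix.IsSymm, transpose_add, transpose_vecMulVec] using h
  simpa [vecMulVec_mulVec, he] using congrArg (· *ᵥ e) hsymm

/-- Solutions of the first-order optimality condition
`SᵀS − e₁e₁ᵀ Sᵀ Ω S = I` are characterized by an eigenpair `(λ, u)` of `Ω` with `λ < 1`. -/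
theorem first_order_condition_characterization
    {n : ℕ} [NeZero n]
    (Om S : Matrix (Fin n) (Fin n) ℝ)
    (hOm : Om.IsSymm)
    (hS : IsUnit S.det)
    (e₁ : Fin n → ℝ) (he₁ : e₁ = Pi.single 0 1)
    (hFOC : Sᵀ * S - vecMulVec e₁ e₁ * Sᵀ * Om * S = 1) :
    ∃ (lam : ℝ) (u : Fin n → ℝ), lam < 1 ∧ u ⬝ᵥ u = 1 ∧ Om.mulVec u = lam • u ∧
      -- (i) Se₁ = (1−λ)^{-1/2} u
      S.mulVec e₁ = (Real.sqrt (1 - lam))⁻¹ • u ∧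
      -- (ii) (Sᵀ)⁻¹e₁ = (1−λ)^{1/2} u
      (Sᵀ)⁻¹.mulVec e₁ = Real.sqrt (1 - lam) • u ∧
      -- (iii) SSᵀ = I + (λ/(1−λ)) uuᵀ
      S * Sᵀ = 1 + (lam / (1 - lam)) • vecMulVec u u := by
  have he : e₁ ⬝ᵥ e₁ = 1 := by simp [he₁]
  clear he₁
  set w := Sᵀ *ᵥ Om *ᵥ S *ᵥ e₁ with hw
  have hgram : Sᵀ * S = 1 + vecMulVec e₁ w := by
    have hrow : e₁ ᵥ* (Sᵀ * (Om * S)) = w := by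
      rw [← mulVec_transpose]
      simp [hw, transpose_mul, hOm.eq, Matrix.mul_assoc]
    rw [Matrix.mul_assoc, Matrix.mul_assoc, vecMulVec_mul, hrow] at hFOC
    exact sub_eq_iff_eq_add.mp hFOC
  obtain ⟨c, hc⟩ : ∃ c : ℝ, w = c • e₁ :=
    ⟨_, eq_smul_of_isSymm_one_add_vecMulVec he (hgram ▸ isSymm_transpose_mul_self S)⟩
  set v := S *ᵥ e₁ with hv
  have hSv : Sᵀ *ᵥ v = (1 + c) • e₁ := by
    rw [hv, mulVec_mulVec, hgram, hc]
    simp [add_mulVec, smul_mulVec, vecMulVec_mulVec, he, add_smul]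
  have hvv : v ⬝ᵥ v = 1 + c := by
    rw [← one_mul (1 + c), ← he, hv, dotProduct_mulVec, ← hv, ← mulVec_transpose, hSv]
    simp [he]
  have hST : IsUnit Sᵀ := (isUnit_iff_isUnit_det _).mpr (by rwa [det_transpose])
  have hinj : Function.Injective (Sᵀ *ᵥ ·) := mulVec_injective_of_isUnit hST
  have hpos : 0 < 1 + c := by
    rw [← hvv]
    refine lt_of_le_of_ne (by simpa using dotProduct_star_self_nonneg v) fun h ↦ ?_
    have hSe : S *ᵥ e₁ = 0 := dotProduct_self_eq_zero.mp h.symm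
    have he₀ : e₁ = 0 := mulVec_injective_of_isUnit ((isUnit_iff_isUnit_det _).mpr hS)
      (by simpa using hSe)
    simp [he₀] at he
  have hOmv : Om *ᵥ v = (c / (1 + c)) • v := by
    apply hinj
    change w = _
    simp only [mulVec_smul, hSv, smul_smul, div_mul_cancel₀ _ hpos.ne', hc]
  have hlam : 1 - c / (1 + c) = (1 + c)⁻¹ := by field_simp; ring
  have hratio : c / (1 + c) / (1 + c)⁻¹ = c := by field_simp
  have hsq : √(1 + c) * √(1 + c) = 1 + c := Real.mul_self_sqrt hpos.le
  have hsqrt : √(1 + c) ≠ 0 := (Real.sqrt_pos.mpr hpos).ne'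
  have hsqinv : (√(1 + c))⁻¹ * (√(1 + c))⁻¹ = (1 + c)⁻¹ := by rw [← mul_inv, hsq]
  refine ⟨c / (1 + c), (√(1 + c))⁻¹ • v, ?_, ?_, ?_, ?_, ?_, ?_⟩
  · rw [div_lt_one hpos]; linarith
  · rw [smul_dotProduct, dotProduct_smul, hvv, smul_smul, hsqinv, smul_eq_mul,
      inv_mul_cancel₀ hpos.ne']
  · rw [mulVec_smul, hOmv, smul_comm]
  · rw [hlam, Real.sqrt_inv, inv_inv, smul_smul, mul_inv_cancel₀ hsqrt, one_smul]
  · rw [hlam, Real.sqrt_inv, smul_smul, hsqinv]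
    apply hinj
    simp only [mulVec_smul, hSv, mulVec_mulVec, smul_smul, inv_mul_cancel₀ hpos.ne', one_smul]
    rw [mul_nonsing_inv _ (by rwa [det_transpose]), one_mulVec]
  · rw [hlam, hratio]
    refine ((isUnit_iff_isUnit_det _).mpr hS).mul_left_injective ?_
    have hvS : v ᵥ* S = (1 + c) • e₁ := by rw [← mulVec_transpose, hSv]
    simp only [Matrix.mul_assoc, hgram, hc, Matrix.mul_add, Matrix.add_mul, Matrix.mul_one,
      Matrix.one_mul, mul_smul_comm, smul_mul_assoc, vecMulVec_mul, mul_vecMulVec, hvS,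
      vecMulVec_smul, smul_vecMulVec, ← hv, smul_smul]
    rw [mul_assoc c, hsqinv, inv_mul_cancel₀ hpos.ne', mul_one]
end

section
/- Let Ω be a real symmetric n×n matrix whose largest eigenvalue λ* (equivalently, λ* = the supremum of uᵀΩu over unit vectors u) satisfies λ* < 1, and let e₁ be the first standard basis vector of ℝⁿ. Then for every real invertible n×n matrix S, −(1/2)·log det(SSᵀ) + (1/2)·tr(SᵀS) − (1/2)·e₁ᵀSᵀΩSe₁ ≥ n/2 + (1/2)·log(1−λ*), and there exists an invertible S for which equality holds. -/
open Matrix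

/-- A positive definite matrix `A` of size `n` satisfies `n ≤ tr A - log det A`. -/
theorem Matrix.PosDef.card_le_trace_sub_log_det {n : Type*} [Fintype n] [DecidableEq n]
    {A : Matrix n n ℝ} (hA : A.PosDef) :
    (Fintype.card n : ℝ) ≤ A.trace - Real.log A.det := by
  have hpos : ∀ i, 0 < hA.isHermitian.eigenvalues i := hA.eigenvalues_pos
  rw [hA.isHermitian.trace_eq_sum_eigenvalues, hA.isHermitian.det_eq_prod_eigenvalues]
  simp only [RCLike.ofReal_real_eq_id, id_eq]
  rw [Real.log_prod fun i _ => (hpos i).ne', ← Finset.sum_sub_distrib]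
  calc (Fintype.card n : ℝ) = ∑ _i : n, (1 : ℝ) := by simp
    _ ≤ _ := Finset.sum_le_sum fun i _ => by
      linarith [Real.log_le_sub_one_of_pos (hpos i)]

/-- A bound on a quadratic form over unit vectors extends to all vectors by homogeneity. -/
theorem Matrix.dotProduct_mulVec_le_of_unit {n : Type*} [Fintype n]
    {A : Matrix n n ℝ} {c : ℝ} (h : ∀ u : n → ℝ, u ⬝ᵥ u = 1 → u ⬝ᵥ A *ᵥ u ≤ c) (v : n → ℝ) :
    v ⬝ᵥ A *ᵥ v ≤ c * (v ⬝ᵥ v) := by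
  by_cases hv : v = 0
  · simp [hv]
  have hpos : 0 < v ⬝ᵥ v :=
    lt_of_le_of_ne (Finset.sum_nonneg fun i _ => mul_self_nonneg (v i))
      fun h0 => hv (dotProduct_self_eq_zero.mp h0.symm)
  have hr : 0 < √(v ⬝ᵥ v) := Real.sqrt_pos.mpr hpos
  have hrr : √(v ⬝ᵥ v) * √(v ⬝ᵥ v) = v ⬝ᵥ v := Real.mul_self_sqrt hpos.le
  have hinv : (√(v ⬝ᵥ v))⁻¹ * (√(v ⬝ᵥ v))⁻¹ = (v ⬝ᵥ v)⁻¹ := by rw [← mul_inv, hrr]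
  have key := h ((√(v ⬝ᵥ v))⁻¹ • v) (by
    rw [smul_dotProduct, dotProduct_smul, smul_eq_mul, smul_eq_mul, ← mul_assoc, hinv,
      inv_mul_cancel₀ hpos.ne'])
  rw [mulVec_smul, smul_dotProduct, dotProduct_smul, smul_eq_mul, smul_eq_mul, ← mul_assoc,
    hinv, inv_mul_le_iff₀ hpos] at key
  linarith

/-- Every unit vector is the image of a given basis vector under an orthogonal matrix
(a Householder reflection). -/
theorem Matrix.exists_orthogonal_mulVec_single {n : Type*} [Fintype n] [DecidableEq n]
    (i : n) {u : n → ℝ} (hu : u ⬝ᵥ u = 1) :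
    ∃ Q : Matrix n n ℝ, Qᵀ * Q = 1 ∧ Q *ᵥ Pi.single i 1 = u := by
  set w : n → ℝ := u - Pi.single i 1 with hw
  set c : ℝ := (1 - u i)⁻¹ with hc
  have hww : w ⬝ᵥ w = 2 * (1 - u i) := by
    simp only [sub_dotProduct, dotProduct_sub, hu, dotProduct_single, single_dotProduct,
      hw, Pi.sub_apply, Pi.single_eq_same]
    ring
  have hcc : c * c * (w ⬝ᵥ w) = 2 * c := by
    rw [hww]
    rcases eq_or_ne (1 - u i) 0 with h | h
    · simp [hc, h]
    · rw [hc]; field_simp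
  refine ⟨1 - c • vecMulVec w w, ?_, ?_⟩
  · have h1 : vecMulVec w w * vecMulVec w w = (w ⬝ᵥ w) • vecMulVec w w := by
      rw [vecMulVec_mul_vecMulVec]
      ext a b
      simp [vecMulVec_apply, mul_left_comm]
    rw [transpose_sub, transpose_smul, transpose_vecMulVec, transpose_one, sub_mul, one_mul,
      mul_sub, mul_one, smul_mul_smul_comm, h1, smul_smul, hcc]
    module
  · have hwi : w i = -(1 - u i) := by simp [hw]
    rw [sub_mulVec, one_mulVec, smul_mulVec, vecMulVec_mulVec, dotProduct_single, hwi]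
    rcases eq_or_ne (1 - u i) 0 with h | h
    · have : w = 0 := dotProduct_self_eq_zero.mp (by rw [hww, h, mul_zero])
      simp [this]
      exact (sub_eq_zero.mp this).symm
    · ext a
      simp [hc, hw]
      field_simp
      ring

/-- Rescaling one column of `S` turns the objective into `(tr (TᵀT) - log det (TᵀT)) / 2`, up to
a constant and the gap between `lam` and the Rayleigh quotient at that column. -/
theorem objective_eq_of_rescaled_column {n : Type*} [Fintype n] [DecidableEq n]
    (A S : Matrix n n ℝ) (i : n) {lam : ℝ} (hlt : lam < 1) (hS : IsUnit S.det) :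
    let T : Matrix n n ℝ := S * diagonal (Function.update 1 i √(1 - lam));
    let v : n → ℝ := S *ᵥ Pi.single i 1;
    -(1/2) * Real.log (S * Sᵀ).det + (1/2) * (Sᵀ * S).trace
        - (1/2) * (Pi.single i 1 ⬝ᵥ (Sᵀ * A * S) *ᵥ Pi.single i 1) =
      (1/2) * ((Tᵀ * T).trace - Real.log (Tᵀ * T).det) + (1/2) * Real.log (1 - lam)
        + (1/2) * (lam * (v ⬝ᵥ v) - v ⬝ᵥ A *ᵥ v) := by
  intro T v
  have hpos : 0 < 1 - lam := sub_pos.mpr hlt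
  have hsq : √(1 - lam) * √(1 - lam) = 1 - lam := Real.mul_self_sqrt hpos.le
  have hdet : (Tᵀ * T).det = (S * Sᵀ).det * (1 - lam) := by
    have hd : (diagonal (Function.update (1 : n → ℝ) i √(1 - lam))).det = √(1 - lam) := by
      rw [det_diagonal, Finset.prod_update_of_mem (Finset.mem_univ i)]
      simp
    simp only [T, det_mul, det_transpose, hd]
    linear_combination S.det * S.det * hsq
  have hS0 : (S * Sᵀ).det ≠ 0 := by
    rw [det_mul, det_transpose]
    exact mul_ne_zero hS.ne_zero hS.ne_zero
  have hquad : Pi.single i 1 ⬝ᵥ (Sᵀ * A * S) *ᵥ Pi.single i 1 = v ⬝ᵥ A *ᵥ v := by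
    simp only [v]
    rw [← mulVec_mulVec, ← mulVec_mulVec, dotProduct_mulVec, vecMul_transpose]
  have hvv : v ⬝ᵥ v = (Sᵀ * S) i i := by
    simp [v, mul_apply, dotProduct]
  have htr : (Tᵀ * T).trace = (Sᵀ * S).trace - lam * (v ⬝ᵥ v) := by
    have hT : Tᵀ * T = diagonal (Function.update 1 i √(1 - lam)) * (Sᵀ * S) *
        diagonal (Function.update 1 i √(1 - lam)) := by
      simp only [T, transpose_mul, diagonal_transpose, Matrix.mul_assoc]
    have hentry : ∀ j, (Tᵀ * T) j j =
        (Sᵀ * S) j j - if j = i then lam * (Sᵀ * S) j j else 0 := by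
      intro j
      rw [hT, mul_diagonal, diagonal_mul]
      by_cases hj : j = i
      · subst hj
        simp only [Function.update_self, if_true]
        linear_combination (Sᵀ * S) j j * hsq
      · simp [hj]
    simp only [trace, diag_apply, hentry, Finset.sum_sub_distrib, hvv]
    simp
  rw [hquad, hdet, htr, Real.log_mul hS0 hpos.ne']
  ring

/-- Exact value of the inner minimization over invertible `S` of
`−(1/2)·log det(SSᵀ) + (1/2)·tr(SᵀS) − (1/2)·e₁ᵀSᵀΩSe₁` when the largest eigenvalue of
the symmetric matrix `Ω` is `λ* < 1`. -/
theorem inner_minimization_value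
    {n : ℕ} [NeZero n]
    (Om : Matrix (Fin n) (Fin n) ℝ) (hOm : Om.IsSymm)
    (lamStar : ℝ)
    -- λ* is the largest eigenvalue of Ω, i.e. the (attained) supremum of uᵀΩu over unit vectors
    (hlam : IsGreatest {x : ℝ | ∃ u : Fin n → ℝ, u ⬝ᵥ u = 1 ∧ u ⬝ᵥ Om.mulVec u = x} lamStar)
    (hlt : lamStar < 1)
    (e₁ : Fin n → ℝ) (he₁ : e₁ = Pi.single 0 1) :
    (∀ S : Matrix (Fin n) (Fin n) ℝ, IsUnit S.det →
      (n : ℝ) / 2 + (1/2) * Real.log (1 - lamStar) ≤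
        -(1/2) * Real.log (S * Sᵀ).det + (1/2) * (Sᵀ * S).trace
          - (1/2) * (e₁ ⬝ᵥ (Sᵀ * Om * S).mulVec e₁)) ∧
    (∃ S : Matrix (Fin n) (Fin n) ℝ, IsUnit S.det ∧
      -(1/2) * Real.log (S * Sᵀ).det + (1/2) * (Sᵀ * S).trace
          - (1/2) * (e₁ ⬝ᵥ (Sᵀ * Om * S).mulVec e₁) =
        (n : ℝ) / 2 + (1/2) * Real.log (1 - lamStar)) := by
  obtain ⟨⟨u, hu, huval⟩, hub⟩ := hlam
  have hs : √(1 - lamStar) ≠ 0 := (Real.sqrt_pos.mpr (sub_pos.mpr hlt)).ne'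
  subst he₁
  refine ⟨fun S hS => ?_, ?_⟩
  · rw [objective_eq_of_rescaled_column Om S 0 hlt hS]
    set T := S * diagonal (Function.update 1 0 √(1 - lamStar)) with hT
    have hTunit : IsUnit T := by
      rw [isUnit_iff_isUnit_det, hT, det_mul, det_diagonal,
        Finset.prod_update_of_mem (Finset.mem_univ 0)]
      simpa using ⟨hS.ne_zero, hs⟩
    have hTpos : (Tᵀ * T).PosDef := by
      rw [← conjTranspose_eq_transpose_of_trivial]
      exact PosDef.conjTranspose_mul_self T (mulVec_injective_of_isUnit hTunit)
    have h1 := hTpos.card_le_trace_sub_log_det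
    have h2 := dotProduct_mulVec_le_of_unit (A := Om) (fun u hu => hub ⟨u, hu, rfl⟩)
      (S *ᵥ Pi.single 0 1)
    rw [Fintype.card_fin] at h1
    linarith
  · obtain ⟨Q, hQ, hQu⟩ := exists_orthogonal_mulVec_single (0 : Fin n) hu
    set D : Matrix (Fin n) (Fin n) ℝ := diagonal (Function.update 1 0 (√(1 - lamStar))⁻¹) with hD
    have hDD : D * diagonal (Function.update 1 0 √(1 - lamStar)) = 1 := by
      rw [hD, diagonal_mul_diagonal, ← diagonal_one]
      congr 1
      ext j
      by_cases hj : j = 0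
      · subst hj
        simp [hs]
      · simp [hj]
    have hDe : D *ᵥ Pi.single 0 1 = (√(1 - lamStar))⁻¹ • Pi.single 0 1 := by
      rw [hD, diagonal_mulVec_single, ← Pi.single_smul]
      simp
    have hS : IsUnit (Q * D).det := by
      rw [det_mul]
      exact (isUnit_det_of_left_inverse hQ).mul (isUnit_det_of_right_inverse hDD)
    refine ⟨Q * D, hS, ?_⟩
    rw [objective_eq_of_rescaled_column Om (Q * D) 0 hlt hS, Matrix.mul_assoc, hDD, Matrix.mul_one,
      hQ, ← mulVec_mulVec, hDe, mulVec_smul, hQu]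
    simp only [mulVec_smul, smul_dotProduct, dotProduct_smul, hu, huval, trace_one, det_one,
      Real.log_one, Fintype.card_fin, smul_eq_mul]
    ring
end

section
/- Let r ∈ (0,1). For a ∈ [−1,1] and η ∈ [0,1] with a²η² ≠ 1, define f̄(a,η) := −a²(1−η)²/(1−a²η²) + (2(1−η)(1−a²η)/(1−a²η²))·(|a|r/(1−η|a|r)). Then f̄(a,η) ≤ r², with equality if and only if |a| = r and η = 0. -/
/-- The binary quadratic form with coefficients `1 + r v`, `-2 (1 - r²)`, `(1 - r²) (1 - r v)` in
`(u, v)`, scaled by its leading coefficient, completed to a sum of squares. -/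
theorem envelope_gap_completed_square (r u v : ℝ) :
    (1 + r * v) * (u ^ 2 * (1 + r * v) - 2 * (1 - r ^ 2) * u * v
        + (1 - r ^ 2) * v ^ 2 * (1 - r * v)) =
      ((1 + r * v) * u - (1 - r ^ 2) * v) ^ 2
        + (1 - r ^ 2) * r ^ 2 * (1 - v ^ 2) * v ^ 2 := by
  ring

/-- The scalar envelope `f̄(a,η)` obtained from the pseudo-true one-state
objective under exponential ergodicity is at most `r²`, with equality iff `|a| = r, η = 0`. -/
theorem scalar_envelope_max
    (r a η : ℝ) (hr : r ∈ Set.Ioo (0:ℝ) 1)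
    (ha : a ∈ Set.Icc (-1:ℝ) 1) (hη : η ∈ Set.Icc (0:ℝ) 1)
    (hane : a ^ 2 * η ^ 2 ≠ 1)
    (fbar : ℝ)
    (hfbar : fbar = -(a ^ 2 * (1 - η) ^ 2) / (1 - a ^ 2 * η ^ 2) +
      (2 * (1 - η) * (1 - a ^ 2 * η) / (1 - a ^ 2 * η ^ 2)) * (|a| * r / (1 - η * |a| * r))) :
    fbar ≤ r ^ 2 ∧ (fbar = r ^ 2 ↔ (|a| = r ∧ η = 0)) := by
  obtain ⟨hr0, hr1⟩ := hr
  obtain ⟨hη0, hη1⟩ := hη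
  have hx0 : 0 ≤ |a| := abs_nonneg a
  have hx1 : |a| ≤ 1 := abs_le.mpr ha
  rw [← sq_abs a] at hane hfbar
  generalize |a| = x at *
  have hv0 : 0 ≤ η * x := mul_nonneg hη0 hx0
  have hv1 : η * x < 1 := by
    refine lt_of_le_of_ne (mul_le_one₀ hη1 hx0 hx1) fun h => hane ?_
    rw [← mul_pow, mul_comm, h, one_pow]
  obtain ⟨v, hv⟩ : ∃ v, v = η * x := ⟨_, rfl⟩
  rw [← hv] at hv0 hv1
  have hq : 0 < 1 - r ^ 2 := by nlinarith
  have hw : 0 < 1 - v ^ 2 := by nlinarith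
  have hd : 0 < 1 - r * v := by nlinarith
  have hs : 0 < 1 + r * v := by positivity
  have hgap : (r ^ 2 - fbar) * ((1 + r * v) * ((1 - v ^ 2) * (1 - r * v))) =
      ((1 + r * v) * (x - r) - (1 - r ^ 2) * v) ^ 2
        + (1 - r ^ 2) * r ^ 2 * (1 - v ^ 2) * v ^ 2 := by
    have h1 : 1 - x ^ 2 * η ^ 2 ≠ 0 := by
      rw [← mul_pow, mul_comm x, ← hv]; exact hw.ne'
    have h2 : 1 - η * x * r ≠ 0 := by
      rw [← hv, mul_comm]; exact hd.ne'
    have h3 : fbar * ((1 - x ^ 2 * η ^ 2) * (1 - η * x * r)) =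
        -(x ^ 2 * (1 - η) ^ 2) * (1 - η * x * r)
          + 2 * (1 - η) * (1 - x ^ 2 * η) * (x * r) := by
      rw [hfbar]
      generalize 1 - η * x * r = d at *
      generalize 1 - x ^ 2 * η ^ 2 = e at *
      field_simp
    rw [← envelope_gap_completed_square, hv]
    linear_combination -(1 + r * (η * x)) * h3
  have hpos : 0 < (1 + r * v) * ((1 - v ^ 2) * (1 - r * v)) := by positivity
  have hc : 0 < (1 - r ^ 2) * r ^ 2 * (1 - v ^ 2) := by positivity
  have hle : fbar ≤ r ^ 2 := by
    have : 0 ≤ r ^ 2 - fbar := nonneg_of_mul_nonneg_left (by rw [hgap]; positivity) hpos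
    linarith
  refine ⟨hle, fun h => ?_, ?_⟩
  · rw [h, sub_self, zero_mul] at hgap
    have hv_zero : v = 0 := by
      have : (1 - r ^ 2) * r ^ 2 * (1 - v ^ 2) * v ^ 2 = 0 :=
        le_antisymm (by nlinarith [sq_nonneg ((1 + r * v) * (x - r) - (1 - r ^ 2) * v)])
          (by positivity)
      simpa [hc.ne'] using this
    subst hv_zero
    have hxr : x = r := by
      have : (x - r) ^ 2 = 0 := by linarith
      exact sub_eq_zero.mp (pow_eq_zero_iff two_ne_zero |>.mp this)
    refine ⟨hxr, ?_⟩
    rcases mul_eq_zero.mp hv.symm with h0 | h0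
    · exact h0
    · exact absurd (hxr.symm.trans h0) hr0.ne'
  · rintro ⟨rfl, rfl⟩
    rw [hfbar]
    ring
end

section
/- Let r ∈ (0,1) and let (C_τ)_{τ≥1} be real symmetric n×n matrices with ‖C_τ‖₂ ≤ r^τ for every τ ≥ 1. For a ∈ [−1,1] and η ∈ [0,1] with a²η² ≠ 1, the series Σ_{τ≥1} a^τ η^{τ−1} C_τ converges, and the symmetric matrix Ω(a,η) := −(a²(1−η)²/(1−a²η²))·I + (2(1−η)(1−a²η)/(1−a²η²))·Σ_{τ≥1} a^τ η^{τ−1} C_τ satisfies uᵀΩ(a,η)u ≤ r² for every unit vector u ∈ ℝⁿ; moreover if (|a|,η) ≠ (r,0) then uᵀΩ(a,η)u < r² for every unit vector u. Finally, if λ ∈ {−r, r} is an eigenvalue of C₁ with unit eigenvector u, then Ω(λ,0)u = λ²·u, so the bound r² is attained at (a,η) = (λ,0). -/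
open Matrix

/-- The spectral norm (ℓ²-operator norm) of a real square matrix. -/
noncomputable def specNorm {m : ℕ} (M : Matrix (Fin m) (Fin m) ℝ) : ℝ :=
  ‖Matrix.toEuclideanCLM (𝕜 := ℝ) M‖

/-- The matrix `Ω(a,η)` built from the lag-τ autocorrelation matrices `C_τ` (for `τ ≥ 1`). -/
noncomputable def OmMat {n : ℕ} (C : ℕ → Matrix (Fin n) (Fin n) ℝ) (a η : ℝ) :
    Matrix (Fin n) (Fin n) ℝ :=
  (-(a ^ 2 * (1 - η) ^ 2 / (1 - a ^ 2 * η ^ 2))) • (1 : Matrix (Fin n) (Fin n) ℝ) +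
    (2 * (1 - η) * (1 - a ^ 2 * η) / (1 - a ^ 2 * η ^ 2)) •
      ∑' τ : ℕ, (a ^ (τ + 1) * η ^ τ) • C (τ + 1)

/-- The quadratic form of a unit vector is bounded by the spectral norm. -/
theorem abs_dotProduct_mulVec_le_specNorm {m : ℕ} (M : Matrix (Fin m) (Fin m) ℝ) (u : Fin m → ℝ)
    (hu : u ⬝ᵥ u = 1) : |u ⬝ᵥ M.mulVec u| ≤ specNorm M := by
  have hnorm : ‖WithLp.toLp 2 u‖ = 1 := by
    rw [EuclideanSpace.norm_eq, Real.sqrt_eq_one, ← hu]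
    simp [dotProduct, sq]
  have hinner : u ⬝ᵥ M.mulVec u =
      inner ℝ (WithLp.toLp 2 u) (Matrix.toEuclideanCLM (𝕜 := ℝ) M (WithLp.toLp 2 u)) := by
    simp [Matrix.toEuclideanCLM_toLp, EuclideanSpace.inner_toLp_toLp, dotProduct_comm]
  rw [hinner]
  refine (abs_real_inner_le_norm _ _).trans ?_
  rw [hnorm, one_mul]
  simpa [specNorm, hnorm] using
    (Matrix.toEuclideanCLM (𝕜 := ℝ) M).le_opNorm (WithLp.toLp 2 u)

open scoped Matrix.Norms.L2Operator in
/-- A series of matrices converges when the spectral norms are dominated by a convergent series. -/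
theorem summable_of_specNorm_le {m : ℕ} {F : ℕ → Matrix (Fin m) (Fin m) ℝ} {g : ℕ → ℝ}
    (hg : Summable g) (h : ∀ k, specNorm (F k) ≤ g k) : Summable F :=
  Summable.of_norm_bounded hg h

theorem specNorm_smul {m : ℕ} (c : ℝ) (M : Matrix (Fin m) (Fin m) ℝ) :
    specNorm (c • M) = |c| * specNorm M := by
  simp [specNorm, norm_smul]

/-- The quadratic form `M ↦ uᵀ M u` as an additive map in the matrix. -/
def quadFormHom {m : ℕ} (u : Fin m → ℝ) : Matrix (Fin m) (Fin m) ℝ →+ ℝ where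
  toFun M := u ⬝ᵥ M.mulVec u
  map_zero' := by simp
  map_add' M N := by simp [Matrix.add_mulVec, dotProduct_add]

theorem continuous_quadFormHom {m : ℕ} (u : Fin m → ℝ) : Continuous (quadFormHom u) := by
  change Continuous fun M : Matrix (Fin m) (Fin m) ℝ => u ⬝ᵥ M.mulVec u
  fun_prop

/-- The scalar inequality behind the bound on `Ω(a,η)`, with `b = |a|`. -/
theorem scalar_Omega_pos {r b η : ℝ} (hr0 : 0 < r) (hr1 : r < 1) (hb : 0 ≤ b) (hη : 0 ≤ η)
    (hbη : b * η < 1) (hne : ¬(b = r ∧ η = 0)) :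
    2 * (1 - η) * (1 - b ^ 2 * η) * (b * r) <
      (r ^ 2 * (1 - b ^ 2 * η ^ 2) + b ^ 2 * (1 - η) ^ 2) * (1 - b * η * r) := by
  have he : 0 ≤ b * η := mul_nonneg hb hη
  have hpos : 0 < 1 + b * η * r := by positivity
  have hr2 : 0 < 1 - r ^ 2 := by nlinarith
  have he2 : 0 < 1 - (b * η) ^ 2 := by nlinarith
  have hsos : 0 < ((1 + b * η * r) * (r - b) + b * η * (1 - r ^ 2)) ^ 2 +
      (b * η) ^ 2 * (1 - r ^ 2) * r ^ 2 * (1 - (b * η) ^ 2) := by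
    rcases he.eq_or_lt with h0 | h0
    · have hd : r - b ≠ 0 := by
        intro h
        have hbr : b = r := by linarith
        rcases mul_eq_zero.mp h0.symm with h1 | h1
        · linarith
        · exact hne ⟨hbr, h1⟩
      rw [← h0]
      have := pow_pos (abs_pos.mpr hd) 2
      rw [sq_abs] at this
      linarith
    · positivity
  have hid : (1 + b * η * r) *
      ((r ^ 2 * (1 - b ^ 2 * η ^ 2) + b ^ 2 * (1 - η) ^ 2) * (1 - b * η * r) -
        2 * (1 - η) * (1 - b ^ 2 * η) * (b * r)) =
      ((1 + b * η * r) * (r - b) + b * η * (1 - r ^ 2)) ^ 2 +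
      (b * η) ^ 2 * (1 - r ^ 2) * r ^ 2 * (1 - (b * η) ^ 2) := by ring
  rw [← hid] at hsos
  linarith [pos_of_mul_pos_right hsos hpos.le]

/-- The non-strict form of `scalar_Omega_pos`, including the equality case. -/
theorem scalar_Omega_nonneg {r b η : ℝ} (hr0 : 0 < r) (hr1 : r < 1) (hb : 0 ≤ b) (hη : 0 ≤ η)
    (hbη : b * η < 1) :
    2 * (1 - η) * (1 - b ^ 2 * η) * (b * r) ≤
      (r ^ 2 * (1 - b ^ 2 * η ^ 2) + b ^ 2 * (1 - η) ^ 2) * (1 - b * η * r) := by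
  by_cases hne : b = r ∧ η = 0
  · obtain ⟨rfl, rfl⟩ := hne
    apply le_of_eq
    ring
  · exact (scalar_Omega_pos hr0 hr1 hb hη hbη hne).le

theorem dotProduct_OmMat_mulVec {n : ℕ} (C : ℕ → Matrix (Fin n) (Fin n) ℝ) (a η : ℝ)
    (u : Fin n → ℝ) (hu : u ⬝ᵥ u = 1) :
    u ⬝ᵥ (OmMat C a η).mulVec u = (2 * (1 - η) * (1 - a ^ 2 * η) *
      (u ⬝ᵥ (∑' τ : ℕ, (a ^ (τ + 1) * η ^ τ) • C (τ + 1)).mulVec u) - a ^ 2 * (1 - η) ^ 2) /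
        (1 - a ^ 2 * η ^ 2) := by
  simp only [OmMat, Matrix.add_mulVec, dotProduct_add, Matrix.smul_mulVec, dotProduct_smul,
    Matrix.one_mulVec, hu, smul_eq_mul]
  ring

/-- Under exponential ergodicity (`‖C_τ‖₂ ≤ r^τ`), the quadratic form of
`Ω(a,η)` on unit vectors is at most `r²`, strictly so away from `(|a|,η) = (r,0)`, and the
bound is attained at `(a,η) = (λ,0)` for an eigenvalue `λ ∈ {−r, r}` of `C₁`. -/
theorem Omega_bound_exponentially_ergodic
    {n : ℕ} (r : ℝ) (hr : r ∈ Set.Ioo (0:ℝ) 1)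
    (C : ℕ → Matrix (Fin n) (Fin n) ℝ)
    (hCsymm : ∀ τ : ℕ, 1 ≤ τ → (C τ).IsSymm)
    (hCnorm : ∀ τ : ℕ, 1 ≤ τ → specNorm (C τ) ≤ r ^ τ) :
    (∀ a η : ℝ, a ∈ Set.Icc (-1:ℝ) 1 → η ∈ Set.Icc (0:ℝ) 1 → a ^ 2 * η ^ 2 ≠ 1 →
      -- the series defining Ω(a,η) converges
      (Summable fun τ : ℕ => (a ^ (τ + 1) * η ^ τ) • C (τ + 1)) ∧
      -- the quadratic form bound
      (∀ u : Fin n → ℝ, u ⬝ᵥ u = 1 → u ⬝ᵥ (OmMat C a η).mulVec u ≤ r ^ 2) ∧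
      -- strict bound away from (|a|, η) = (r, 0)
      (¬(|a| = r ∧ η = 0) →
        ∀ u : Fin n → ℝ, u ⬝ᵥ u = 1 → u ⬝ᵥ (OmMat C a η).mulVec u < r ^ 2)) ∧
    -- attainment at an extreme eigenvalue of C₁
    (∀ (lam : ℝ) (u : Fin n → ℝ), (lam = r ∨ lam = -r) → u ⬝ᵥ u = 1 →
      (C 1).mulVec u = lam • u → (OmMat C lam 0).mulVec u = lam ^ 2 • u) := by
  obtain ⟨hr0, hr1⟩ := hr
  refine ⟨fun a η ha hη hne => ?_, fun lam u hlam hu hev => ?_⟩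
  · obtain ⟨hη0, hη1⟩ := hη
    have hb0 : 0 ≤ |a| := abs_nonneg a
    have hb1 : |a| ≤ 1 := abs_le.mpr ha
    have hbη : |a| * η < 1 := by
      refine lt_of_le_of_ne (mul_le_one₀ hb1 hη0 hη1) fun h => hne ?_
      rw [← sq_abs, ← mul_pow, h, one_pow]
    have hbηr0 : 0 ≤ |a| * η * r := by positivity
    have hbηr1 : |a| * η * r < 1 := by nlinarith
    have hgeo : HasSum (fun τ : ℕ => |a| * r * (|a| * η * r) ^ τ)
        (|a| * r * (1 - |a| * η * r)⁻¹) :=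
      (hasSum_geometric_of_lt_one hbηr0 hbηr1).mul_left _
    have hterm : ∀ τ : ℕ, specNorm ((a ^ (τ + 1) * η ^ τ) • C (τ + 1)) ≤
        |a| * r * (|a| * η * r) ^ τ := by
      intro τ
      rw [specNorm_smul, abs_mul, abs_pow, abs_pow, abs_of_nonneg hη0]
      calc |a| ^ (τ + 1) * η ^ τ * specNorm (C (τ + 1))
          ≤ |a| ^ (τ + 1) * η ^ τ * r ^ (τ + 1) := by
            gcongr
            exact hCnorm _ (Nat.succ_pos τ)
        _ = |a| * r * (|a| * η * r) ^ τ := by ring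
    have hsum := summable_of_specNorm_le hgeo.summable hterm
    have hden : 0 < 1 - a ^ 2 * η ^ 2 := by
      rw [← sq_abs, ← mul_pow]
      nlinarith [mul_nonneg hb0 hη0]
    have hcoef : 0 ≤ 2 * (1 - η) * (1 - a ^ 2 * η) := by
      have h1 : a ^ 2 * η ≤ 1 := mul_le_one₀ (by rw [← sq_abs]; exact pow_le_one₀ hb0 hb1) hη0 hη1
      exact mul_nonneg (by linarith) (by linarith)
    have hS : ∀ u : Fin n → ℝ, u ⬝ᵥ u = 1 →
        u ⬝ᵥ (∑' τ : ℕ, (a ^ (τ + 1) * η ^ τ) • C (τ + 1)).mulVec u ≤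
          |a| * r / (1 - |a| * η * r) := by
      intro u hu
      refine hasSum_le (fun τ => ?_)
        (hsum.hasSum.map (quadFormHom u) (continuous_quadFormHom u)) hgeo
      exact (le_abs_self _).trans ((abs_dotProduct_mulVec_le_specNorm _ u hu).trans (hterm τ))
    have hq : 0 < 1 - |a| * η * r := by linarith
    have hmul : ∀ u : Fin n → ℝ, u ⬝ᵥ u = 1 →
        2 * (1 - η) * (1 - a ^ 2 * η) *
          (u ⬝ᵥ (∑' τ : ℕ, (a ^ (τ + 1) * η ^ τ) • C (τ + 1)).mulVec u) ≤
        2 * (1 - η) * (1 - a ^ 2 * η) * (|a| * r) / (1 - |a| * η * r) := fun u hu => by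
      rw [mul_div_assoc]
      exact mul_le_mul_of_nonneg_left (hS u hu) hcoef
    refine ⟨hsum, fun u hu => ?_, fun hstrict u hu => ?_⟩
    · have h := scalar_Omega_nonneg hr0 hr1 hb0 hη0 hbη
      rw [sq_abs, ← div_le_iff₀ hq] at h
      rw [dotProduct_OmMat_mulVec C a η u hu, div_le_iff₀ hden]
      linarith [hmul u hu]
    · have h := scalar_Omega_pos hr0 hr1 hb0 hη0 hbη hstrict
      rw [sq_abs, ← div_lt_iff₀ hq] at h
      rw [dotProduct_OmMat_mulVec C a η u hu, div_lt_iff₀ hden]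
      linarith [hmul u hu]
  · have htsum : ∑' τ : ℕ, (lam ^ (τ + 1) * (0 : ℝ) ^ τ) • C (τ + 1) = lam • C 1 := by
      rw [tsum_eq_single 0 fun τ hτ => by simp [hτ]]
      simp
    rw [OmMat, htsum, Matrix.add_mulVec, Matrix.smul_mulVec, Matrix.smul_mulVec,
      Matrix.smul_mulVec, Matrix.one_mulVec, hev]
    simp only [smul_smul, ← add_smul]
    congr 1
    ring
end

section
/- Let d, n ≥ 1, let M be a real d×d matrix, D a real n×d matrix, and N an invertible real n×n matrix. Define A := M, B := Dᵀ N^{−1} (a d×n matrix), Q := I_d − M (I_d − DᵀD) Mᵀ, and R := (N^{−1})ᵀ (I_n − DDᵀ) N^{−1}. Then: (i) Bᵀ B + R = (NNᵀ)^{−1}, which is invertible; (ii) the d×d identity matrix Σ := I_d satisfies the algebraic Riccati equation Σ = A( Σ − Σ B (Bᵀ Σ B + R)^{−1} Bᵀ Σ ) Aᵀ + Q; and (iii) the associated Kalman gain K := A Σ B (Bᵀ Σ B + R)^{−1} equals M Dᵀ Nᵀ. -/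
open Matrix

/-- The reparameterization `(M, D, N)` of a `d`-state linear-Gaussian
state-space model `(A, B, Q, R)` normalizes the steady-state conditional variance of the
state to the identity and gives the Kalman gain in closed form. -/
theorem state_space_reparameterization
    {d n : ℕ} (hd : 0 < d) (hn : 0 < n)
    (M : Matrix (Fin d) (Fin d) ℝ)
    (D : Matrix (Fin n) (Fin d) ℝ)
    (N : Matrix (Fin n) (Fin n) ℝ) (hN : IsUnit N.det)
    (A : Matrix (Fin d) (Fin d) ℝ) (hA : A = M)
    (B : Matrix (Fin d) (Fin n) ℝ) (hB : B = Dᵀ * N⁻¹)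
    (Q : Matrix (Fin d) (Fin d) ℝ) (hQ : Q = 1 - M * (1 - Dᵀ * D) * Mᵀ)
    (R : Matrix (Fin n) (Fin n) ℝ) (hR : R = (N⁻¹)ᵀ * (1 - D * Dᵀ) * N⁻¹) :
    -- (i) BᵀB + R = (NNᵀ)⁻¹, which is invertible
    (Bᵀ * B + R = (N * Nᵀ)⁻¹ ∧ IsUnit (Bᵀ * B + R).det) ∧
    -- (ii) Σ = I_d solves the algebraic Riccati equation
    ((1 : Matrix (Fin d) (Fin d) ℝ) =
      A * ((1 : Matrix (Fin d) (Fin d) ℝ) -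
        (1 : Matrix (Fin d) (Fin d) ℝ) * B * (Bᵀ * (1 : Matrix (Fin d) (Fin d) ℝ) * B + R)⁻¹ *
          Bᵀ * (1 : Matrix (Fin d) (Fin d) ℝ)) * Aᵀ + Q) ∧
    -- (iii) the Kalman gain equals M Dᵀ Nᵀ
    (A * (1 : Matrix (Fin d) (Fin d) ℝ) * B * (Bᵀ * (1 : Matrix (Fin d) (Fin d) ℝ) * B + R)⁻¹ =
      M * Dᵀ * Nᵀ) := by
  have hNT : IsUnit Nᵀ.det := by rwa [det_transpose]
  have hNN : IsUnit (N * Nᵀ).det := by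
    rw [det_mul]
    exact hN.mul hNT
  have hS : Bᵀ * B + R = (N * Nᵀ)⁻¹ := by
    rw [hB, hR, transpose_mul, transpose_transpose, Matrix.mul_inv_rev, ← transpose_nonsing_inv]
    simp only [Matrix.mul_sub, Matrix.sub_mul, Matrix.mul_one, Matrix.mul_assoc, add_sub_cancel]
  have hG : B * (Bᵀ * B + R)⁻¹ = Dᵀ * Nᵀ := by
    rw [hS, nonsing_inv_nonsing_inv _ hNN, hB, Matrix.mul_assoc, nonsing_inv_mul_cancel_left _ _ hN]
  have hGB : B * (Bᵀ * B + R)⁻¹ * Bᵀ = Dᵀ * D := by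
    rw [hG, hB, transpose_mul, transpose_transpose, transpose_nonsing_inv, Matrix.mul_assoc,
      mul_nonsing_inv_cancel_left _ _ hNT]
  refine ⟨⟨hS, ?_⟩, ?_, ?_⟩
  · rw [hS]
    exact isUnit_nonsing_inv_det _ hNN
  · simp only [Matrix.one_mul, Matrix.mul_one]
    rw [hGB, hQ, hA, add_sub_cancel]
  · simp only [Matrix.mul_one]
    rw [Matrix.mul_assoc, hG, hA, Matrix.mul_assoc]
end

section
/- Let Λ be a real d×d diagonal matrix all of whose diagonal entries have absolute value strictly less than 1, and let S be a real invertible d×d matrix with SSᵀ = (I − Λ²)^{−1}. Set A := Sᵀ Λ (Sᵀ)^{−1}. Then the series P := Σ_{τ=0}^∞ A^τ (Aᵀ)^τ converges and equals SᵀS; in particular P satisfies the discrete Lyapunov equation P = A P Aᵀ + I, and (S^{−1})ᵀ P S^{−1} = I. -/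
open Matrix

/-- The powers `Λ ^ τ (1 - Λ²) Λ ^ τ` of a diagonal contraction telescope to the identity. -/
theorem hasSum_diagonal_pow_mul_one_sub_sq {ι : Type*} [Fintype ι] [DecidableEq ι]
    {l : ι → ℝ} (hl : ∀ i, |l i| < 1) :
    HasSum (fun τ : ℕ => diagonal l ^ τ * (1 - diagonal l ^ 2) * diagonal l ^ τ) 1 := by
  have hsum : HasSum (fun (τ : ℕ) (i : ι) => (l i ^ 2) ^ τ * (1 - l i ^ 2)) 1 := by
    refine Pi.hasSum.2 fun i => ?_
    have hlt : l i ^ 2 < 1 := (sq_lt_one_iff_abs_lt_one _).2 (hl i)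
    have hgeom := (hasSum_geometric_of_lt_one (sq_nonneg (l i)) hlt).mul_right (1 - l i ^ 2)
    rwa [inv_mul_cancel₀ (sub_pos.2 hlt).ne'] at hgeom
  have hdiag := hsum.matrix_diagonal
  rw [show diagonal (1 : ι → ℝ) = 1 from diagonal_one] at hdiag
  convert hdiag using 2 with τ
  rw [← diagonal_one, diagonal_pow, diagonal_pow, diagonal_sub, diagonal_mul_diagonal,
    diagonal_mul_diagonal]
  congr 1
  ext i
  simp only [Pi.pow_apply]
  ring

/-- A diagonal matrix with entries of absolute value less than one has `1 - Λ²` invertible. -/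
theorem isUnit_det_one_sub_diagonal_sq {ι : Type*} [Fintype ι] [DecidableEq ι]
    {l : ι → ℝ} (hl : ∀ i, |l i| < 1) : IsUnit (1 - diagonal l ^ 2).det := by
  rw [← diagonal_one, diagonal_pow, diagonal_sub, det_diagonal, isUnit_iff_ne_zero]
  refine Finset.prod_ne_zero_iff.2 fun i _ => ne_of_gt ?_
  exact sub_pos.2 ((sq_lt_one_iff_abs_lt_one _).2 (hl i))

/-- Powers of a conjugate of `Λ` by an invertible matrix. -/
theorem conj_pow_of_isUnit_det {ι R : Type*} [Fintype ι] [DecidableEq ι] [CommRing R]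
    {M : Matrix ι ι R} (hM : IsUnit M.det) (Λ : Matrix ι ι R) (τ : ℕ) :
    (M * Λ * M⁻¹) ^ τ = M * Λ ^ τ * M⁻¹ := by
  induction τ with
  | zero => simp [mul_nonsing_inv _ hM]
  | succ k ih =>
    rw [pow_succ, ih, pow_succ]
    simp only [Matrix.mul_assoc, nonsing_inv_mul_cancel_left _ _ hM]

/-- In transformed coordinates, the stationary state variance
`P = Σ_{τ≥0} A^τ (Aᵀ)^τ` of the pseudo-true model with `A = SᵀΛ(Sᵀ)⁻¹` equals `SᵀS`,
solves the discrete Lyapunov equation `P = APAᵀ + I`, and yields identity unconditional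
observable variance. -/
theorem stationary_variance_transformed_coordinates
    {d : ℕ}
    (Λ : Matrix (Fin d) (Fin d) ℝ)
    (hΛdiag : ∀ i j : Fin d, i ≠ j → Λ i j = 0)
    (hΛlt : ∀ i : Fin d, |Λ i i| < 1)
    (S : Matrix (Fin d) (Fin d) ℝ) (hS : IsUnit S.det)
    (hSS : S * Sᵀ = (1 - Λ ^ 2)⁻¹)
    (A : Matrix (Fin d) (Fin d) ℝ) (hA : A = Sᵀ * Λ * (Sᵀ)⁻¹) :
    (Summable fun τ : ℕ => A ^ τ * (Aᵀ) ^ τ) ∧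
    (∑' τ : ℕ, A ^ τ * (Aᵀ) ^ τ) = Sᵀ * S ∧
    Sᵀ * S = A * (Sᵀ * S) * Aᵀ + 1 ∧
    (S⁻¹)ᵀ * (Sᵀ * S) * S⁻¹ = 1 := by
  obtain ⟨l, rfl⟩ : ∃ l, Λ = diagonal l :=
    ⟨fun i => Λ i i, by
      ext i j
      by_cases h : i = j
      · subst h; simp
      · simp [h, hΛdiag i j h]⟩
  have hl : ∀ i, |l i| < 1 := fun i => by simpa using hΛlt i
  have hST : IsUnit Sᵀ.det := by rwa [det_transpose]
  have hU := isUnit_det_one_sub_diagonal_sq hl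
  have hinv : (Sᵀ)⁻¹ * S⁻¹ = 1 - diagonal l ^ 2 := by
    rw [← Matrix.mul_inv_rev, hSS, nonsing_inv_nonsing_inv _ hU]
  have hpow (τ : ℕ) : A ^ τ = Sᵀ * diagonal l ^ τ * (Sᵀ)⁻¹ := by
    rw [hA, conj_pow_of_isUnit_det hST]
  have hpowT (τ : ℕ) : (Aᵀ) ^ τ = S⁻¹ * diagonal l ^ τ * S := by
    rw [← transpose_pow, hpow, transpose_mul, transpose_mul, transpose_nonsing_inv,
      transpose_transpose, transpose_pow, diagonal_transpose, Matrix.mul_assoc]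
  have hterm (τ : ℕ) : A ^ τ * (Aᵀ) ^ τ =
      Sᵀ * (diagonal l ^ τ * (1 - diagonal l ^ 2) * diagonal l ^ τ) * S := by
    rw [hpow, hpowT, ← hinv]
    simp only [Matrix.mul_assoc]
  have hsum : HasSum (fun τ : ℕ => A ^ τ * (Aᵀ) ^ τ) (Sᵀ * S) := by
    simpa only [hterm, Matrix.mul_one] using
      ((hasSum_diagonal_pow_mul_one_sub_sq hl).mul_left Sᵀ).mul_right S
  refine ⟨hsum.summable, hsum.tsum_eq, ?_, ?_⟩
  · have hshift : HasSum (fun τ : ℕ => A ^ (τ + 1) * (Aᵀ) ^ (τ + 1)) (A * (Sᵀ * S) * Aᵀ) := by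
      have hstep (τ : ℕ) : A ^ (τ + 1) * (Aᵀ) ^ (τ + 1) = A * (A ^ τ * (Aᵀ) ^ τ) * Aᵀ := by
        rw [pow_succ', pow_succ]
        simp only [Matrix.mul_assoc]
      simpa only [hstep] using (hsum.mul_left A).mul_right Aᵀ
    simpa using hsum.unique ((hasSum_nat_add_iff 1).1 hshift)
  · rw [transpose_nonsing_inv, nonsing_inv_mul_cancel_left _ _ hST, mul_nonsing_inv _ hS]
end
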